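/- Let A be a torsion-free abelian group, let H be a subgroup of A with positive cone Q of a left-ordering, and let Q̄ = {a ∈ I_A(H) : a^k ∈ Q for some integer k > 0} be the unique extension of Q to a positive cone of the isolator I_A(H). If C is a subgroup of H that is convex relative to Q, then I_A(C) is a subgroup of I_A(H) that is convex relative to Q̄. -/

import Mathlib

/-- `P` is the positive cone of a left-ordering of `G`: closed under multiplication,
and `G` is the disjoint union of `P`, `P⁻¹` and `{1}`. -/
def IsLeftCone {G : Type*} [Group G] (P : Set G) : Prop :=
  (∀ a ∈ P, ∀ b ∈ P, a * b ∈ P) ∧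
  (∀ g : G, g ∈ P ∨ g⁻¹ ∈ P ∨ g = 1) ∧
  (∀ g ∈ P, g⁻¹ ∉ P) ∧
  (1 : G) ∉ P

/-- `P` has a least element with respect to the left-order it defines. -/
def ConeHasLeast {G : Type*} [Group G] (P : Set G) : Prop :=
  ∃ p ∈ P, ∀ q ∈ P, q = p ∨ p⁻¹ * q ∈ P

/-- `P` is the positive cone of a dense left-ordering of `G`. -/
def IsDenseCone {G : Type*} [Group G] (P : Set G) : Prop :=
  IsLeftCone P ∧ ¬ ConeHasLeast P

/-- `P` is a Conradian positive cone. -/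
def IsConradianCone {G : Type*} [Group G] (P : Set G) : Prop :=
  ∀ g ∈ P, ∀ h ∈ P, g⁻¹ * h * g ^ 2 ∈ P

/-- The subgroup `C` is convex relative to the positive cone `P`. -/
def IsConvexSubgroup {G : Type*} [Group G] (P : Set G) (C : Subgroup G) : Prop :=
  ∀ g ∈ C, ∀ h ∈ C, ∀ f : G, g⁻¹ * f ∈ P → f⁻¹ * h ∈ P → f ∈ C

/-- `G` is bi-orderable: it admits a positive cone invariant under conjugation. -/
def IsBiOrderable (G : Type*) [Group G] : Prop :=
  ∃ P : Set G, IsLeftCone P ∧ ∀ g : G, ∀ p ∈ P, g * p * g⁻¹ ∈ P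

/-- `Q` is the positive cone of a left-ordering of the subset `X` of `G` (viewed inside
`G`). -/
def IsLeftConeOn {G : Type*} [Group G] (X : Set G) (Q : Set G) : Prop :=
  Q ⊆ X ∧
  (∀ a ∈ Q, ∀ b ∈ Q, a * b ∈ Q) ∧
  (∀ g ∈ X, g ∈ Q ∨ g⁻¹ ∈ Q ∨ g = 1) ∧
  (∀ g ∈ Q, g⁻¹ ∉ Q) ∧
  (1 : G) ∉ Q

/-- The subset `C` of `X` is convex relative to the positive cone `P` of `X`. -/
def IsConvexOn {G : Type*} [Group G] (X P C : Set G) : Prop :=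
  ∀ g ∈ C, ∀ h ∈ C, ∀ f ∈ X, g⁻¹ * f ∈ P → f⁻¹ * h ∈ P → f ∈ C

/-- The isolator of a subset `A` of a group `G`. -/
def isolator {G : Type*} [Group G] (A : Set G) : Set G :=
  {g : G | ∃ k : ℤ, k ≠ 0 ∧ g ^ k ∈ A}

/-- The canonical extension of a positive cone `Q` of a subgroup `H` to the isolator of
`H`. -/
def coneExt {G : Type*} [Group G] (H : Set G) (Q : Set G) : Set G :=
  {a ∈ isolator H | ∃ k : ℤ, 0 < k ∧ a ^ k ∈ Q}

theorem Subgroup.zpow_mem_of_dvd {G : Type*} [Group G] (C : Subgroup G) {a : G} {k n : ℤ}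
    (h : a ^ k ∈ C) (hkn : k ∣ n) : a ^ n ∈ C := by
  obtain ⟨m, rfl⟩ := hkn
  rw [zpow_mul]
  exact C.zpow_mem h m

theorem zpow_mem_of_mul_closed {G : Type*} [Group G] {Q : Set G}
    (hQ : ∀ a ∈ Q, ∀ b ∈ Q, a * b ∈ Q) {a : G} {k n : ℤ}
    (hk : 0 < k) (h : a ^ k ∈ Q) (hn : 0 < n) (hkn : k ∣ n) : a ^ n ∈ Q := by
  obtain ⟨m, rfl⟩ := hkn
  have hm : 0 < m := pos_of_mul_pos_right hn hk.le
  rw [zpow_mul]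
  induction m, hm using Int.leInduction with
  | base => simpa using h
  | succ m hm ih =>
    rw [zpow_add_one]
    exact hQ _ (ih (mul_pos hk hm)) _ h

/-- If `C ≤ H` is convex relative to a positive cone `Q` of `H` in a torsion-free abelian
group `A`, then `I_A(C)` is a subgroup of `I_A(H)` convex relative to the extension of `Q`
to `I_A(H)`. -/
theorem isolator_of_convex_is_convex {A : Type*} [CommGroup A]
    (hTF : ∀ a : A, a ≠ 1 → ¬ IsOfFinOrder a)
    (H : Subgroup A) (Q : Set A) (hQ : IsLeftConeOn (H : Set A) Q)
    (C : Subgroup A) (hCH : C ≤ H)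
    (hconv : IsConvexOn (H : Set A) Q (C : Set A)) :
    isolator (C : Set A) ⊆ isolator (H : Set A) ∧
    (1 : A) ∈ isolator (C : Set A) ∧
    (∀ a ∈ isolator (C : Set A), ∀ b ∈ isolator (C : Set A),
      a * b ∈ isolator (C : Set A)) ∧
    (∀ a ∈ isolator (C : Set A), a⁻¹ ∈ isolator (C : Set A)) ∧
    IsConvexOn (isolator (H : Set A)) (coneExt (H : Set A) Q) (isolator (C : Set A)) := by
  refine ⟨?_, ⟨1, one_ne_zero, by simp⟩, ?_, ?_, ?_⟩
  · rintro a ⟨k, hk, ha⟩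
    exact ⟨k, hk, hCH ha⟩
  · rintro a ⟨k, hk, ha⟩ b ⟨l, hl, hb⟩
    refine ⟨k * l, mul_ne_zero hk hl, ?_⟩
    rw [mul_zpow]
    exact C.mul_mem (C.zpow_mem_of_dvd ha (dvd_mul_right k l))
      (C.zpow_mem_of_dvd hb (dvd_mul_left l k))
  · rintro a ⟨k, hk, ha⟩
    refine ⟨k, hk, ?_⟩
    rw [inv_zpow]
    exact C.inv_mem ha
  · rintro g ⟨m, hm, hg⟩ h ⟨n, hn, hh⟩ f ⟨l, hl, hf⟩ ⟨-, i, hi, hgf⟩ ⟨-, j, hj, hfh⟩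
    obtain ⟨N, hN⟩ : ∃ N : ℤ, N = (m * n * l) ^ 2 * (i * j) := ⟨_, rfl⟩
    have hpos : 0 < N := by rw [hN]; positivity
    have hgfN := zpow_mem_of_mul_closed hQ.2.1 hi hgf hpos
      ⟨(m * n * l) ^ 2 * j, by rw [hN]; ring⟩
    have hfhN := zpow_mem_of_mul_closed hQ.2.1 hj hfh hpos
      ⟨(m * n * l) ^ 2 * i, by rw [hN]; ring⟩
    rw [mul_zpow, inv_zpow] at hgfN hfhN
    exact ⟨N, hpos.ne', hconv _
      (C.zpow_mem_of_dvd hg ⟨m * (n * l) ^ 2 * (i * j), by rw [hN]; ring⟩) _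
      (C.zpow_mem_of_dvd hh ⟨n * (m * l) ^ 2 * (i * j), by rw [hN]; ring⟩) _
      (H.zpow_mem_of_dvd hf ⟨l * (m * n) ^ 2 * (i * j), by rw [hN]; ring⟩) hgfN hfhN⟩
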